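/- arXiv:2208.02153 — 3 statements merged into one kernel-verified Lean document; each statement's English description precedes it below -/
import Mathlib

section
/- Let T be a finite tree with n ≥ 2 vertices, let L be the number of leaves of T, and let K be the maximum, over all simple paths Q in T whose two endpoints are leaves, of the number of vertices on Q having degree at most 2 in T. Then the minimum number of unbounded vertices of a walk in T that visits every vertex of T equals n − (L + K − 2). -/
open SimpleGraph

namespace UHP
variable {V : Type*} [Fintype V] [DecidableEq V] {G : SimpleGraph V} [DecidableRel G.Adj]

theorem pen_unique (hT : G.IsTree) {a x y : V} (w : G.Walk a y) (hw : x ∉ w.support)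
    (h : G.Adj y x) (p : G.Walk a x) (hp : p.IsPath) : y = p.penultimate := by
  have h1 : (w.bypass.concat h).IsPath :=
    (w.bypass_isPath).concat (fun hx => hw (w.support_bypass_subset hx)) h
  have h2 : (⟨_, h1⟩ : G.Path a x) = ⟨p, hp⟩ := hT.isAcyclic.path_unique _ _
  have h3 : w.bypass.concat h = p := congrArg Subtype.val h2
  rw [← h3]; simp

theorem avoid {a b x y : V} (W : G.Walk a b) (hy : y ∈ W.support) (hxy : y ≠ x)
    (hc : ¬ 1 < W.support.count x) :
    (∃ w : G.Walk a y, x ∉ w.support) ∨ (∃ w : G.Walk y b, x ∉ w.support) := by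
  by_contra! hcon
  have h1 := hcon.1 (W.takeUntil y hy)
  have h2 := hcon.2 (W.dropUntil y hy)
  rw [Walk.mem_support_iff] at h2
  have h3 := h2.resolve_left hxy.symm
  apply hc
  rw [← W.take_spec hy, Walk.support_append, List.count_append]
  have := List.count_pos_iff.2 h1
  have := List.count_pos_iff.2 h3
  omega

theorem bounded_cases (hT : G.IsTree) {a b x : V} (W : G.Walk a b) (hW : ∀ x, x ∈ W.support)
    (hc : ¬ 1 < W.support.count x) (R : G.Walk a b) :
    G.degree x ≤ 1 ∨ (G.degree x = 2 ∧ x ∈ R.support) := by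
  obtain ⟨p, hp⟩ := hT.connected.exists_isPath a x
  obtain ⟨q, hq⟩ := hT.connected.exists_isPath b x
  have h2 : G.degree x ≤ 2 := by
    rw [← G.card_neighborFinset_eq_degree]
    refine (Finset.card_le_card (t := {p.penultimate, q.penultimate}) ?_).trans Finset.card_le_two
    intro y hy
    rw [mem_neighborFinset] at hy
    rcases avoid W (hW y) hy.ne' hc with ⟨w, hw⟩ | ⟨w, hw⟩
    · simp [← pen_unique hT w hw hy.symm p hp]
    · simp [← pen_unique hT w.reverse (by simpa using hw) hy.symm q hq]
  by_cases hx : x ∈ R.support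
  · have : G.degree x ≤ 1 ∨ G.degree x = 2 := by omega
    tauto
  · left
    rw [← G.card_neighborFinset_eq_degree]
    refine (Finset.card_le_card (t := {p.penultimate}) ?_).trans (by simp)
    intro y hy
    rw [mem_neighborFinset] at hy
    rcases avoid W (hW y) hy.ne' hc with ⟨w, hw⟩ | ⟨w, hw⟩
    · simp [← pen_unique hT w hw hy.symm p hp]
    · simp [← pen_unique hT (R.append w.reverse) (by simp [Walk.mem_support_append_iff, hx, hw])
        hy.symm p hp]

theorem degree_pos' (hT : G.IsTree) (hn : 2 ≤ Fintype.card V) (v : V) : 0 < G.degree v := by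
  haveI : Nontrivial V := Fintype.one_lt_card_iff_nontrivial.1 hn
  exact hT.connected.preconnected.degree_pos_of_nontrivial v

theorem ext_path (hT : G.IsTree) (hn : 2 ≤ Fintype.card V) {a b : V} (P : G.Walk a b)
    (hP : P.IsPath) (h : G.degree a ≠ 1 ∨ a = b) :
    ∃ (z : V) (hz : G.Adj z a), (Walk.cons hz P).IsPath := by
  have hpos := degree_pos' hT hn a
  have key : ∀ z, G.Adj a z → z ∈ P.support → z = P.snd := by
    intro z hz hzP
    have h1 : (P.takeUntil z hzP).IsPath := hP.takeUntil hzP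
    have h2 : (Walk.cons hz Walk.nil).IsPath := by simp [hz.ne]
    have h3 : P.takeUntil z hzP = Walk.cons hz Walk.nil :=
      congrArg Subtype.val (hT.isAcyclic.path_unique ⟨_, h1⟩ ⟨_, h2⟩)
    rw [← P.take_spec hzP, h3]
    simp
  have : ∃ z, G.Adj a z ∧ z ∉ P.support := by
    by_cases hab : a = b
    · subst hab
      obtain ⟨z, hz⟩ := (G.degree_pos_iff_exists_adj a).1 hpos
      refine ⟨z, hz, ?_⟩
      rw [Walk.isPath_iff_eq_nil] at hP
      subst hP
      simpa using hz.ne'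
    · have h1 := h.resolve_right hab
      have h2 : 1 < (G.neighborFinset a).card := by
        rw [G.card_neighborFinset_eq_degree]; omega
      obtain ⟨z, hz, hne⟩ := Finset.exists_mem_ne h2 P.snd
      rw [mem_neighborFinset] at hz
      exact ⟨z, hz, fun hh => hne (key z hz hh)⟩
  obtain ⟨z, hz, hzP⟩ := this
  exact ⟨z, hz.symm, hP.cons hzP⟩

theorem ext_leaf (hT : G.IsTree) (hn : 2 ≤ Fintype.card V) (k : ℕ) :
    ∀ {a b : V} (P : G.Walk a b), P.IsPath → Fintype.card V ≤ P.length + k →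
    ∃ (a' b' : V) (Q : G.Walk a' b'), Q.IsPath ∧ P.support ⊆ Q.support ∧
      G.degree a' = 1 ∧ G.degree b' = 1 ∧ a' ≠ b' := by
  induction k with
  | zero => intro a b P hP hk; have := hP.length_lt; omega
  | succ k ih =>
    intro a b P hP hk
    by_cases h1 : G.degree a ≠ 1 ∨ a = b
    · obtain ⟨z, hz, hh⟩ := ext_path hT hn P hP h1
      obtain ⟨a', b', Q, hQ, hs, h⟩ := ih _ hh (by simp; omega)
      exact ⟨a', b', Q, hQ, fun x hx => hs (by simp [hx]), h⟩
    · by_cases h2 : G.degree b ≠ 1 ∨ b = a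
      · obtain ⟨z, hz, hh⟩ := ext_path hT hn P.reverse hP.reverse h2
        obtain ⟨a', b', Q, hQ, hs, h⟩ := ih _ hh (by simp; omega)
        exact ⟨a', b', Q, hQ, fun x hx => hs (by simp [hx]), h⟩
      · push Not at h1 h2
        exact ⟨a, b, P, hP, fun x hx => hx, h1.1, h2.1, h1.2⟩

theorem exists_two_nbrs {a b u : V} (Q : G.Walk a b) (hQ : Q.IsPath) (hu : u ∈ Q.support)
    (ha : u ≠ a) (hb : u ≠ b) :
    ∃ y z, y ≠ z ∧ G.Adj u y ∧ G.Adj u z ∧ y ∈ Q.support ∧ z ∈ Q.support := by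
  have hn1 : ¬ (Q.takeUntil u hu).Nil := fun h => ha h.eq.symm
  have hn2 : ¬ (Q.dropUntil u hu).Nil := fun h => hb h.eq
  have hpen := (Q.takeUntil u hu).adj_penultimate hn1
  have hsnd := (Q.dropUntil u hu).adj_snd hn2
  have h1 : (Q.takeUntil u hu).penultimate ∈ (Q.takeUntil u hu).support :=
    Walk.getVert_mem_support _ _
  have h2 : (Q.dropUntil u hu).snd ∈ (Q.dropUntil u hu).support := Walk.getVert_mem_support _ _
  refine ⟨_, _, ?_, hpen.symm, hsnd, Q.support_takeUntil_subset hu h1,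
    Q.support_dropUntil_subset hu h2⟩
  intro heq
  have hnd := hQ.support_nodup
  rw [← Q.take_spec hu, Walk.support_append, List.nodup_append] at hnd
  rw [Walk.mem_support_iff] at h2
  exact hnd.2.2 _ h1 _ (h2.resolve_left hsnd.ne') heq

theorem two_le_degree {u y z : V} (hyz : y ≠ z) (hy : G.Adj u y) (hz : G.Adj u z) :
    2 ≤ G.degree u := by
  rw [← G.card_neighborFinset_eq_degree, ← Finset.card_pair hyz]
  apply Finset.card_le_card
  intro t ht
  simp only [Finset.mem_insert, Finset.mem_singleton] at ht
  rcases ht with rfl | rfl <;> simpa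

theorem three_le_degree {u y z v : V} (hyz : y ≠ z) (hv1 : v ≠ y) (hv2 : v ≠ z)
    (hy : G.Adj u y) (hz : G.Adj u z) (hv : G.Adj u v) : 3 ≤ G.degree u := by
  have : ({v, y, z} : Finset V).card = 3 := by simp [*]
  rw [← G.card_neighborFinset_eq_degree, ← this]
  apply Finset.card_le_card
  intro t ht
  simp only [Finset.mem_insert, Finset.mem_singleton] at ht
  rcases ht with rfl | rfl | rfl <;> simpa

/-- A vertex of a nontrivial walk has a neighbour on the walk. -/
theorem exists_nbr {a b u : V} (W : G.Walk a b) (hab : a ≠ b) (hu : u ∈ W.support) :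
    ∃ y, G.Adj u y ∧ y ∈ W.support := by
  by_cases hb : u = b
  · have hn : ¬ (W.takeUntil u hu).Nil := fun h => hab (h.eq.trans hb)
    exact ⟨_, ((W.takeUntil u hu).adj_penultimate hn).symm,
      W.support_takeUntil_subset hu (Walk.getVert_mem_support _ _)⟩
  · have hn : ¬ (W.dropUntil u hu).Nil := fun h => hb h.eq
    exact ⟨_, (W.dropUntil u hu).adj_snd hn,
      W.support_dropUntil_subset hu (Walk.getVert_mem_support _ _)⟩

theorem exists_boundary (hT : G.IsTree) (S : Set V) {s t : V} (hs : s ∈ S) (ht : t ∉ S) :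
    ∃ u v, G.Adj u v ∧ u ∈ S ∧ v ∉ S := by
  obtain ⟨w⟩ := hT.connected.preconnected s t
  obtain ⟨d, -, h1, h2⟩ := w.exists_boundary_dart S hs ht
  exact ⟨_, _, d.adj, h1, h2⟩

theorem build (hT : G.IsTree) {a b : V} (hab : a ≠ b) (Q : G.Walk a b) (hQ : Q.IsPath)
    (hda : G.degree a = 1) (hdb : G.degree b = 1) (k : ℕ) :
    ∀ W : G.Walk a b, Q.support ⊆ W.support →
      (∀ x, 1 < W.support.count x → 2 ≤ G.degree x ∧ (x ∈ Q.support → 3 ≤ G.degree x)) →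
      Fintype.card V ≤ W.support.toFinset.card + k →
    ∃ W' : G.Walk a b, (∀ x, x ∈ W'.support) ∧
      (∀ x, 1 < W'.support.count x → 2 ≤ G.degree x ∧ (x ∈ Q.support → 3 ≤ G.degree x)) := by
  induction k with
  | zero =>
    intro W _ hI hk
    refine ⟨W, fun x => ?_, hI⟩
    have : W.support.toFinset = Finset.univ := by
      apply Finset.eq_univ_of_card
      exact le_antisymm (Finset.card_le_univ _) (by omega)
    have hx := Finset.mem_univ x
    rw [← this] at hx
    simpa using hx
  | succ k ih =>
    intro W hs hI hk
    by_cases hall : ∀ x, x ∈ W.support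
    · exact ⟨W, hall, hI⟩
    push Not at hall
    obtain ⟨t, ht⟩ := hall
    obtain ⟨u, v, huv, hu, hv⟩ := exists_boundary hT {x | x ∈ W.support}
      (W.start_mem_support) ht
    simp only [Set.mem_setOf_eq] at hu hv
    set W' := (W.takeUntil u hu).append
      (Walk.cons huv (Walk.cons huv.symm (W.dropUntil u hu))) with hW'
    have hcount : ∀ x, W'.support.count x = W.support.count x
        + (if x = u then 1 else 0) + (if x = v then 1 else 0) := by
      intro x
      have h1 : W.support = (W.takeUntil u hu).support ++ (W.dropUntil u hu).support.tail := by
        rw [← Walk.support_append, W.take_spec hu]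
      have h2 : W'.support = (W.takeUntil u hu).support ++
          (v :: u :: (W.dropUntil u hu).support.tail) := by
        rw [hW', Walk.support_append, Walk.support_cons, Walk.support_cons, List.tail_cons,
          ← Walk.support_eq_cons]
      rw [h1, h2]
      simp only [List.count_append, List.count_cons, beq_iff_eq, eq_comm (a := x)]
      omega
    have hmem : ∀ x, x ∈ W'.support ↔ x ∈ W.support ∨ x = v := by
      intro x
      rw [← List.count_pos_iff, ← List.count_pos_iff, hcount]
      have := List.count_pos_iff.2 hu
      by_cases hx : x = u
      · subst hx; simp [hu]
      · by_cases hx' : x = v <;> simp [hx, hx']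
    refine ih W' (fun x hx => (hmem x).2 (Or.inl (hs hx))) ?_ ?_
    · intro x hx
      rw [hcount] at hx
      by_cases hxu : x = u
      · subst hxu
        obtain ⟨y, hy, hyW⟩ := exists_nbr W hab hu
        have h2 := two_le_degree (y := y) (z := v) (fun h => hv (h ▸ hyW)) hy huv
        refine ⟨h2, fun hxQ => ?_⟩
        by_cases hxa : x = a ∨ x = b
        · rcases hxa with rfl | rfl <;> omega
        · push Not at hxa
          obtain ⟨y, z, hyz, hy, hz, hyQ, hzQ⟩ := exists_two_nbrs Q hQ hxQ hxa.1 hxa.2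
          exact three_le_degree (v := v) hyz (fun h => hv (h ▸ hs hyQ)) (fun h => hv (h ▸ hs hzQ)) hy hz huv
      · by_cases hxv : x = v
        · subst hxv
          rw [List.count_eq_zero_of_not_mem hv] at hx
          simp [hxu] at hx
        · apply hI; simpa [hxu, hxv] using hx
    · have : W'.support.toFinset = insert v W.support.toFinset := by
        ext x; simp [hmem, or_comm]
      rw [this, Finset.card_insert_of_notMem (by simpa using hv)]
      omega
end UHP



/-- Let `T` be a finite tree with `n ≥ 2` vertices, `L` its number of leaves, and `K` the
maximum, over simple paths `Q` whose endpoints are leaves, of the number of vertices on `Q`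
of degree at most 2.  Then the minimum number of unbounded vertices (vertices occurring more
than once) of a walk visiting every vertex of `T` equals `n - (L + K - 2)`. -/
theorem tree_min_unbounded_hamiltonian_path_eq
    {V : Type*} [Fintype V] [DecidableEq V] (G : SimpleGraph V) [DecidableRel G.Adj]
    (hT : G.IsTree) (hn : 2 ≤ Fintype.card V) (L K m : ℕ)
    (hL : L = (Finset.univ.filter fun v : V => G.degree v = 1).card)
    (hK : IsGreatest {k : ℕ | ∃ (a b : V) (P : G.Path a b),
        G.degree a = 1 ∧ G.degree b = 1 ∧
        k = ((P : G.Walk a b).support.filter (fun x : V => G.degree x ≤ 2)).length} K)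
    (hm : IsLeast {k : ℕ | ∃ (a b : V) (W : G.Walk a b),
        (∀ x : V, x ∈ W.support) ∧
        (Finset.univ.filter fun x : V => 1 < W.support.count x).card = k} m) :
    m = Fintype.card V - (L + K - 2) := by
  have hcardV : ∀ S : Finset V, S.card + Sᶜ.card = Fintype.card V := fun S =>
    Finset.card_add_card_compl S
  set Lf : Finset V := Finset.univ.filter fun v : V => G.degree v = 1 with hLf
  -- translation of the list length to a finset
  have hlen : ∀ {a b : V} (Q : G.Walk a b), Q.IsPath →
      (Q.support.filter (fun x : V => G.degree x ≤ 2)).length =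
        (Finset.univ.filter fun x : V => x ∈ Q.support ∧ G.degree x ≤ 2).card := by
    intro a b Q hQ
    rw [← List.toFinset_card_of_nodup (hQ.support_nodup.filter _)]
    congr 1
    ext x; simp
  have hK2 : ∀ {a b : V} (R : G.Walk a b), R.IsPath →
      (Finset.univ.filter fun x : V => x ∈ R.support ∧ G.degree x = 2).card + 2 ≤ K := by
    intro a b R hR
    obtain ⟨a', b', Q, hQ, hs, ha, hb, hne⟩ := UHP.ext_leaf hT hn (Fintype.card V) R hR (by omega)
    have h1 := hK.2 ⟨a', b', ⟨Q, hQ⟩, ha, hb, rfl⟩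
    refine le_trans ?_ h1
    show _ ≤ (Q.support.filter (fun x : V => G.degree x ≤ 2)).length
    have hpair : ∀ t : ℕ, t + 2 = t + ({a', b'} : Finset V).card := by
      intro t; rw [Finset.card_pair hne]
    rw [hlen Q hQ, hpair, ← Finset.card_union_of_disjoint]
    · apply Finset.card_le_card
      intro x hx
      simp only [Finset.mem_union, Finset.mem_filter, Finset.mem_univ, true_and,
        Finset.mem_insert, Finset.mem_singleton] at hx ⊢
      rcases hx with ⟨h, h'⟩ | rfl | rfl
      · exact ⟨hs h, h'.le⟩
      · exact ⟨Q.start_mem_support, by omega⟩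
      · exact ⟨Q.end_mem_support, by omega⟩
    · rw [Finset.disjoint_left]
      intro x hx hx'
      simp only [Finset.mem_filter, Finset.mem_univ, true_and,
        Finset.mem_insert, Finset.mem_singleton] at hx hx'
      rcases hx' with rfl | rfl <;> omega
  have hlow : Fintype.card V ≤ m + (L + K - 2) := by
    obtain ⟨a, b, W, hW, hWm⟩ := hm.1
    obtain ⟨R, hR⟩ := hT.connected.exists_isPath a b
    have hk := hK2 R hR
    have hsub : (Finset.univ.filter fun x : V => 1 < W.support.count x)ᶜ ⊆
        Lf ∪ (Finset.univ.filter fun x : V => x ∈ R.support ∧ G.degree x = 2) := by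
      intro x hx
      have hx : ¬ 1 < W.support.count x := by simpa using hx
      have hpos := UHP.degree_pos' hT hn x
      simp only [hLf, Finset.mem_union, Finset.mem_filter, Finset.mem_univ, true_and]
      rcases UHP.bounded_cases hT W hW hx R with h | ⟨h, h'⟩
      · left; omega
      · exact Or.inr ⟨h', h⟩
    have h1 := (Finset.card_le_card hsub).trans (Finset.card_union_le _ _)
    have h2 := hcardV (Finset.univ.filter fun x : V => 1 < W.support.count x)
    omega
  have hup : m + (L + K - 2) ≤ Fintype.card V := by
    obtain ⟨a, b, ⟨Q, hQ⟩, ha, hb, hKQ⟩ := hK.1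
    change K = (Q.support.filter (fun x : V => G.degree x ≤ 2)).length at hKQ
    have hab : a ≠ b := by
      rintro rfl
      have := hK2 Q hQ
      rw [Walk.isPath_iff_eq_nil] at hQ
      subst hQ
      simp [ha] at hKQ
      omega
    obtain ⟨W, hW, hI⟩ := UHP.build hT hab Q hQ ha hb (Fintype.card V) Q (fun x hx => hx)
      (fun x hx => absurd hx (by
        have := List.nodup_iff_count_le_one.1 hQ.support_nodup x
        omega)) (by omega)
    have hmle := hm.2 ⟨a, b, W, hW, rfl⟩
    rw [hlen Q hQ] at hKQ
    set A := (Finset.univ.filter fun x : V => x ∈ Q.support ∧ G.degree x ≤ 2) with hA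
    have hsub : Lf ∪ A ⊆ (Finset.univ.filter fun x : V => 1 < W.support.count x)ᶜ := by
      intro x hx
      simp only [hLf, hA, Finset.mem_union, Finset.mem_filter, Finset.mem_univ, true_and] at hx
      simp only [Finset.mem_compl, Finset.mem_filter, Finset.mem_univ, true_and]
      intro hc
      obtain ⟨h1, h2⟩ := hI x hc
      rcases hx with hx | ⟨hx, hx'⟩
      · omega
      · have := h2 hx; omega
    have hint : (Lf ∩ A).card ≤ 2 := by
      refine (Finset.card_le_card (t := {a, b}) ?_).trans Finset.card_le_two
      intro x hx
      simp only [hLf, hA, Finset.mem_inter, Finset.mem_filter, Finset.mem_univ, true_and] at hx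
      by_contra hcon
      simp only [Finset.mem_insert, Finset.mem_singleton, not_or] at hcon
      obtain ⟨y, z, hyz, hy, hz, -⟩ := UHP.exists_two_nbrs Q hQ hx.2.1 hcon.1 hcon.2
      have := UHP.two_le_degree hyz hy hz
      omega
    have h1 := Finset.card_le_card hsub
    have h2 := hcardV (Finset.univ.filter fun x : V => 1 < W.support.count x)
    have h3 := Finset.card_union_add_card_inter Lf A
    omega
  omega
end

section
/- For every integer n divisible by 4 with n ≥ 8, the generalized Petersen graph GP(n, n/2) contains no 1-Unbounded Hamiltonian Cycle; that is, there is no walk in GP(n, n/2) that visits every vertex, has adjacent start and end vertices, and in which exactly one vertex occurs more than once. -/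
open SimpleGraph

/-- The base relation of the generalized Petersen graph `GP(n,k)`: outer vertices `Sum.inl i`
(the `u_i`) and inner vertices `Sum.inr i` (the `v_i`), with edges `u_i u_{i+1}`, `u_i v_i`,
and `v_i v_{i+k}`, indices modulo `n`. -/
def gpRel (n k : ℕ) : (Fin n ⊕ Fin n) → (Fin n ⊕ Fin n) → Prop
  | Sum.inl i, Sum.inl j => (j : ℕ) = ((i : ℕ) + 1) % n
  | Sum.inl i, Sum.inr j => (i : ℕ) = (j : ℕ)
  | Sum.inr i, Sum.inr j => (j : ℕ) = ((i : ℕ) + k) % n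
  | _, _ => False

/-- The generalized Petersen graph `GP(n,k)`. -/
def generalizedPetersen (n k : ℕ) : SimpleGraph (Fin n ⊕ Fin n) :=
  SimpleGraph.fromRel (gpRel n k)

/-- The antipodal index `i + n/2`. -/
def gpAnti (n : ℕ) (i : Fin n) : Fin n := ⟨((i : ℕ) + n / 2) % n, Nat.mod_lt _ i.pos⟩

/-- The next index. -/
def gpNext (n : ℕ) (i : Fin n) : Fin n := ⟨((i : ℕ) + 1) % n, Nat.mod_lt _ i.pos⟩

/-- The previous index. -/
def gpPrev (n : ℕ) (i : Fin n) : Fin n := ⟨((i : ℕ) + (n - 1)) % n, Nat.mod_lt _ i.pos⟩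

lemma gp_mod_cases (a n : ℕ) (h : a < 2 * n) :
    (a < n ∧ a % n = a) ∨ (n ≤ a ∧ a % n = a - n) := by
  rcases lt_or_ge a n with h1 | h1
  · exact Or.inl ⟨h1, Nat.mod_eq_of_lt h1⟩
  · right
    refine ⟨h1, ?_⟩
    rw [Nat.mod_eq_sub_mod h1, Nat.mod_eq_of_lt (by omega)]

lemma gp_adj_inr (n : ℕ) (h4 : 4 ∣ n) (i : Fin n) (y : Fin n ⊕ Fin n)
    (h : (generalizedPetersen n (n / 2)).Adj (Sum.inr i) y) :
    y = Sum.inl i ∨ y = Sum.inr (gpAnti n i) := by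
  obtain ⟨m, rfl⟩ := h4
  rcases y with j | j
  · simp only [generalizedPetersen, SimpleGraph.fromRel_adj, gpRel] at h
    left
    congr 1
    ext
    simpa using h.2
  · simp only [generalizedPetersen, SimpleGraph.fromRel_adj, gpRel] at h
    right
    congr 1
    ext
    have hi := i.2
    have hj := j.2
    simp only [gpAnti]
    have h1 := gp_mod_cases (i + 4 * m / 2) (4 * m) (by omega)
    have h2 := gp_mod_cases (j + 4 * m / 2) (4 * m) (by omega)
    omega

lemma gp_adj_inl (n : ℕ) (h8 : 8 ≤ n) (i : Fin n) (y : Fin n ⊕ Fin n)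
    (h : (generalizedPetersen n (n / 2)).Adj (Sum.inl i) y) :
    y = Sum.inr i ∨ y = Sum.inl (gpNext n i) ∨ y = Sum.inl (gpPrev n i) := by
  rcases y with j | j
  · simp only [generalizedPetersen, SimpleGraph.fromRel_adj, gpRel] at h
    right
    simp only [Sum.inl.injEq, Fin.ext_iff, gpNext, gpPrev]
    have hi := i.2
    have hj := j.2
    have h1 := gp_mod_cases (i + 1) n (by omega)
    have h2 := gp_mod_cases (j + 1) n (by omega)
    have h3 := gp_mod_cases (i + (n - 1)) n (by omega)
    omega
  · simp only [generalizedPetersen, SimpleGraph.fromRel_adj, gpRel] at h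
    left
    congr 1
    ext
    have h2 := h.2
    simp only [or_false] at h2
    exact h2.symm

lemma gp_anti_anti (n : ℕ) (h4 : 4 ∣ n) (i : Fin n) : gpAnti n (gpAnti n i) = i := by
  obtain ⟨m, rfl⟩ := h4
  ext
  have hi := i.2
  simp only [gpAnti]
  have h1 := gp_mod_cases (i + 4 * m / 2) (4 * m) (by omega)
  have h2 := gp_mod_cases ((i + 4 * m / 2) % (4 * m) + 4 * m / 2) (4 * m) (by omega)
  omega

lemma gp_anti_ne (n : ℕ) (h8 : 8 ≤ n) (i : Fin n) : gpAnti n i ≠ i := by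
  intro h
  have h := congrArg Fin.val h
  have hi := i.2
  simp only [gpAnti] at h
  have h1 := gp_mod_cases (i + n / 2) n (by omega)
  omega

/-- For every neighbour `x` of an outer vertex there is another vertex `y` whose neighbours
are only `x` and some `z`, different from the outer vertex. -/
lemma gp_key (n : ℕ) (h4 : 4 ∣ n) (h8 : 8 ≤ n) (j : Fin n) (x : Fin n ⊕ Fin n)
    (h : (generalizedPetersen n (n / 2)).Adj (Sum.inl j) x) :
    ∃ y z, y ≠ Sum.inl j ∧ z ≠ Sum.inl j ∧
      ∀ t, (generalizedPetersen n (n / 2)).Adj y t → t = x ∨ t = z := by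
  rcases x with i | i
  · refine ⟨Sum.inr i, Sum.inr (gpAnti n i), by simp, by simp, gp_adj_inr n h4 i⟩
  · have hij : i = j := by
      rcases gp_adj_inl n h8 j _ h with h | h | h
      · simpa using h
      · simp at h
      · simp at h
    subst hij
    refine ⟨Sum.inr (gpAnti n i), Sum.inl (gpAnti n i), by simp, ?_, ?_⟩
    · simpa using gp_anti_ne n h8 i
    · intro t ht
      have := gp_adj_inr n h4 _ t ht
      rw [gp_anti_anti n h4] at this
      exact this.symm

lemma gp_cyclic (n : ℕ) (h4 : 4 ∣ n) (h8 : 8 ≤ n) (L : ℕ) (hL : 5 ≤ L)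
    (f : ZMod L → Fin n ⊕ Fin n)
    (hadj : ∀ p, (generalizedPetersen n (n / 2)).Adj (f p) (f (p + 1)))
    (hsurj : ∀ x, ∃ p, f p = x) (w : Fin n ⊕ Fin n)
    (hinj : ∀ p q, f p ≠ w → f p = f q → p = q)
    (hw : ∃ p q, p ≠ q ∧ f p = w ∧ f q = w) : False := by
  have hnum : ∀ k : ℕ, 0 < k → k < L → (k : ZMod L) ≠ 0 := by
    intro k hk hkL h
    rw [ZMod.natCast_eq_zero_iff] at h
    exact absurd (Nat.le_of_dvd hk h) (by omega)
  have h2 : (2 : ZMod L) ≠ 0 := by exact_mod_cast hnum 2 (by omega) (by omega)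
  have h4' : (4 : ZMod L) ≠ 0 := by exact_mod_cast hnum 4 (by omega) (by omega)
  have hpm : ∀ p : ZMod L, p + 1 ≠ p - 1 := by
    intro p h
    apply h2
    linear_combination h
  have hadj' : ∀ p, (generalizedPetersen n (n / 2)).Adj (f p) (f (p - 1)) := by
    intro p
    have := hadj (p - 1)
    rw [sub_add_cancel] at this
    exact this.symm
  obtain ⟨p, q, hpq, hp, hq⟩ := hw
  have hnw : ∀ p, f p = w → f (p + 1) ≠ w ∧ f (p - 1) ≠ w := by
    intro p hp
    have h1 := (hadj p).ne
    have h2 := (hadj' p).ne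
    rw [hp] at h1 h2
    exact ⟨h1.symm, h2.symm⟩
  have eqs : ∀ a b, f a ≠ w → a ≠ b → f a ≠ f b := fun a b ha hab h => hab (hinj a b ha h)
  have n1 := eqs _ _ (hnw p hp).1 (hpm p)
  have n2 := eqs _ _ (hnw q hq).1 (hpm q)
  have n3 := eqs (p + 1) (q + 1) (hnw p hp).1 (fun h => hpq (add_right_cancel h))
  have n4 := eqs (p - 1) (q - 1) (hnw p hp).2 (fun h => hpq (sub_left_injective h))
  have a1 := hadj p
  have a2 := hadj' p
  have a3 := hadj q
  have a4 := hadj' q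
  rw [hp] at a1 a2
  rw [hq] at a3 a4
  rcases w with j | j
  · -- a leaf excursion is impossible
    have leaf : ∀ r, f r = Sum.inl j → f (r + 1 + 1) = Sum.inl j → False := by
      intro r hr hr2
      have ha := hadj r
      rw [hr] at ha
      obtain ⟨y, z, hy, hz, hN⟩ := gp_key n h4 h8 j _ ha
      obtain ⟨s, rfl⟩ := hsurj y
      have e1 : f (s + 1) = z := by
        rcases hN _ (hadj s) with h | h
        · have := hinj _ _ (hnw r hr).1 h.symm
          have hs : s = r := (add_right_cancel this).symm
          exact absurd (hs ▸ hr) hy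
        · exact h
      have e2 : f (s - 1) = z := by
        rcases hN _ (hadj' s) with h | h
        · have := hinj _ _ (hnw r hr).1 h.symm
          have hs : s = r + 1 + 1 := by linear_combination -this
          exact absurd (hs ▸ hr2) hy
        · exact h
      exact hpm s (hinj _ _ (e1 ▸ hz) (e1.trans e2.symm))
    have b1 := gp_adj_inl n h8 _ _ a1
    have b2 := gp_adj_inl n h8 _ _ a2
    have b3 := gp_adj_inl n h8 _ _ a3
    have b4 := gp_adj_inl n h8 _ _ a4
    have : f (p + 1) = f (q - 1) ∨ f (p - 1) = f (q + 1) := by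
      clear leaf eqs hnw hinj hadj hadj' hsurj
      grind
    rcases this with h | h
    · have := hinj _ _ (hnw p hp).1 h
      apply leaf p hp
      rw [this, sub_add_cancel, hq]
    · have := hinj _ _ (hnw p hp).2 h
      apply leaf q hq
      rw [← this, sub_add_cancel, hp]
  · have b1 := gp_adj_inr n h4 _ _ a1
    have b2 := gp_adj_inr n h4 _ _ a2
    have b3 := gp_adj_inr n h4 _ _ a3
    have b4 := gp_adj_inr n h4 _ _ a4
    have : f (p + 1) = f (q - 1) ∧ f (p - 1) = f (q + 1) := by
      clear eqs hnw hinj hadj hadj' hsurj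
      grind
    have c1 := hinj _ _ (hnw p hp).1 this.1
    have c2 := hinj _ _ (hnw p hp).2 this.2
    apply h4'
    linear_combination c1 - c2

lemma gp_beq (n : ℕ) (x y : Fin n ⊕ Fin n) :
    (x == y) = @BEq.beq _ instBEqOfDecidableEq x y := by
  have h : @BEq.beq _ instBEqOfDecidableEq x y = decide (x = y) := rfl
  rw [h]
  rcases x with x | x <;> rcases y with y | y
  · have h1 : ((Sum.inl x : Fin n ⊕ Fin n) == Sum.inl y) = (x == y) := rfl
    rw [h1, Bool.eq_iff_iff]
    simp
  · have h1 : ((Sum.inl x : Fin n ⊕ Fin n) == Sum.inr y) = false := rfl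
    rw [h1]
    simp
  · have h1 : ((Sum.inr x : Fin n ⊕ Fin n) == Sum.inl y) = false := rfl
    rw [h1]
    simp
  · have h1 : ((Sum.inr x : Fin n ⊕ Fin n) == Sum.inr y) = (x == y) := rfl
    rw [h1, Bool.eq_iff_iff]
    simp

/-- For every `n` divisible by `4` with `n ≥ 8`, the generalized Petersen graph `GP(n, n/2)`
contains no 1-Unbounded Hamiltonian Cycle: there is no walk visiting every vertex, with
adjacent start and end vertices, in which exactly one vertex occurs more than once. -/
theorem generalizedPetersen_no_one_unbounded_hamiltonian_cycle
    (n : ℕ) (h4 : 4 ∣ n) (h8 : 8 ≤ n) :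
    ¬ ∃ (a b : Fin n ⊕ Fin n) (_ : (generalizedPetersen n (n / 2)).Adj a b)
        (W : (generalizedPetersen n (n / 2)).Walk a b),
      (∀ x : Fin n ⊕ Fin n, x ∈ W.support) ∧
      (Finset.univ.filter fun x : Fin n ⊕ Fin n => 1 < W.support.count x).card = 1 := by
  rintro ⟨a, b, hab, W, hall, hcard⟩
  obtain ⟨w, hw⟩ := Finset.card_eq_one.mp hcard
  have hw' : ∀ x, 1 < W.support.count x ↔ x = w := by
    intro x
    have := Finset.ext_iff.mp hw x
    simpa using this
  let f : ZMod (W.length + 1) → Fin n ⊕ Fin n := fun p => W.getVert p.val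
  have hsurj : ∀ x, ∃ p, f p = x := by
    intro x
    obtain ⟨k, hk, hkl⟩ := SimpleGraph.Walk.mem_support_iff_exists_getVert.mp (hall x)
    refine ⟨(k : ZMod (W.length + 1)), ?_⟩
    simp only [f]
    rw [ZMod.val_natCast, Nat.mod_eq_of_lt (by omega), hk]
  have hL : 5 ≤ W.length + 1 := by
    have := Fintype.card_le_of_surjective f hsurj
    rw [ZMod.card] at this
    simp at this
    omega
  have hdup : ∀ x, 1 < W.support.count x ↔
      ∃ p q : ZMod (W.length + 1), p ≠ q ∧ f p = x ∧ f q = x := by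
    intro x
    have h12 : 1 < W.support.count x ↔
        2 ≤ @List.count _ instBEqOfDecidableEq x W.support := by
      have hc : W.support.count x = @List.count _ instBEqOfDecidableEq x W.support := by
        unfold List.count
        congr 1
        funext y
        exact gp_beq n y x
      rw [hc]
      exact Iff.rfl
    rw [h12, ← List.duplicate_iff_two_le_count,
      List.duplicate_iff_exists_distinct_get]
    constructor
    · rintro ⟨i, j, hij, hi, hj⟩
      have hlen := SimpleGraph.Walk.length_support W
      have hi2 : (i : ℕ) < W.length + 1 := by omega
      have hj2 : (j : ℕ) < W.length + 1 := by omega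
      refine ⟨((i : ℕ) : ZMod (W.length + 1)), ((j : ℕ) : ZMod (W.length + 1)), ?_, ?_, ?_⟩
      · intro h
        have := congrArg ZMod.val h
        rw [ZMod.val_natCast, ZMod.val_natCast, Nat.mod_eq_of_lt hi2, Nat.mod_eq_of_lt hj2] at this
        have := Fin.lt_def.mp hij
        omega
      · simp only [f]
        rw [ZMod.val_natCast, Nat.mod_eq_of_lt hi2, hi]
        simp [SimpleGraph.Walk.support_getElem_eq_getVert]
      · simp only [f]
        rw [ZMod.val_natCast, Nat.mod_eq_of_lt hj2, hj]
        simp [SimpleGraph.Walk.support_getElem_eq_getVert]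
    · have main : ∀ p q : ZMod (W.length + 1), p.val < q.val → f p = x → f q = x →
          ∃ (i j : Fin W.support.length) (_ : i < j), x = W.support.get i ∧ x = W.support.get j := by
        intro p q hpq hp hq
        have hlen := SimpleGraph.Walk.length_support W
        have hp2 : p.val < W.support.length := lt_of_lt_of_eq (ZMod.val_lt p) hlen.symm
        have hq2 : q.val < W.support.length := lt_of_lt_of_eq (ZMod.val_lt q) hlen.symm
        refine ⟨⟨p.val, hp2⟩, ⟨q.val, hq2⟩, hpq, ?_, ?_⟩
        · simp [SimpleGraph.Walk.support_getElem_eq_getVert, ← hp, f]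
        · simp [SimpleGraph.Walk.support_getElem_eq_getVert, ← hq, f]
      rintro ⟨p, q, hpq, hp, hq⟩
      rcases lt_trichotomy p.val q.val with h | h | h
      · exact main p q h hp hq
      · exact absurd (ZMod.val_injective _ h) hpq
      · exact main q p h hq hp
  refine gp_cyclic n h4 h8 (W.length + 1) hL f ?_ hsurj w ?_ ((hdup w).mp ((hw' w).mpr rfl))
  · intro p
    have hp := ZMod.val_lt p
    have hval : (p + 1).val = (p.val + 1) % (W.length + 1) := by
      rw [ZMod.val_add, ZMod.val_one'' (by omega)]
    simp only [f]
    rw [hval]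
    rcases Nat.lt_or_ge p.val W.length with h | h
    · rw [Nat.mod_eq_of_lt (by omega)]
      exact W.adj_getVert_succ h
    · have : p.val = W.length := by omega
      rw [this, Nat.mod_self]
      simpa using hab.symm
  · intro p q hp hpq
    by_contra hne
    exact hp ((hw' _).mp ((hdup _).mpr ⟨p, q, hne, rfl, hpq.symm⟩))
end

section
/- For every integer n divisible by 4 with n > 8, the generalized Petersen graph GP(n, n/2) contains a 3-Unbounded Hamiltonian Cycle; that is, there exists a walk in GP(n, n/2) that visits every vertex, has adjacent start and end vertices, and in which exactly three vertices occur more than once. Combined with the nonexistence of a 1-Unbounded Hamiltonian Cycle, the minimum k for which GP(n, n/2) contains a k-Unbounded Hamiltonian Cycle satisfies 2 ≤ m ≤ 3. -/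
open SimpleGraph

/-- Abstract data: links of a cyclic walk in which only `x` may be visited repeatedly. -/
structure LinkCfg {α : Type} (m : ℕ) (x : α) (T : α → α → Prop) (U V : ℤ → α) : Prop where
  hm : 3 ≤ m
  symm : ∀ a b, T a b → T b a
  le2 : ∀ y, y ≠ x → ∀ a b c, T y a → T y b → T y c → a = b ∨ a = c ∨ b = c
  ge2 : ∀ y, y ≠ x → (∃ a b, a ≠ b ∧ T y a ∧ T y b) ∨ (T y x ∧ ∀ a, T y a → a = x)
  conn : ∀ S : Set α, ∀ y ∈ S, (∀ a ∈ S, ∀ b, T a b → b ∈ S) → ∀ z, z ∈ S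
  hU : ∀ i z, T (U i) z → z = U (i + 1) ∨ z = U (i - 1) ∨ z = V i
  hV : ∀ i z, T (V i) z → z = U i ∨ z = V (i + 2 * m)
  perU : ∀ i, U (i + 4 * m) = U i
  perV : ∀ i, V (i + 4 * m) = V i
  injU : ∀ i j, U i = U j → (4 * m : ℤ) ∣ i - j
  injV : ∀ i j, V i = V j → (4 * m : ℤ) ∣ i - j
  neUV : ∀ i j, U i ≠ V j
  hx : x = U 0 ∨ x = V 0 ∨ x = U (2 * m) ∨ x = V (2 * m)

namespace LinkCfg

theorem small {N d : ℤ} (h : N ∣ d) (h1 : -N < d) (h2 : d < N) : d = 0 :=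
  Int.eq_zero_of_abs_lt_dvd h (abs_lt.2 ⟨h1, h2⟩)

variable {α : Type} {m : ℕ} {x : α} {T : α → α → Prop} {U V : ℤ → α}

theorem shift (c : LinkCfg m x T U V) :
    LinkCfg m x T (fun i => U (i + 2 * m)) (fun i => V (i + 2 * m)) where
  hm := c.hm
  symm := c.symm
  le2 := c.le2
  ge2 := c.ge2
  conn := c.conn
  hU i z h := by
    have := c.hU _ _ h
    rwa [show i + 2 * (m : ℤ) + 1 = i + 1 + 2 * m by ring,
      show i + 2 * (m : ℤ) - 1 = i - 1 + 2 * m by ring] at this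
  hV i z h := c.hV _ _ h
  perU i := by
    have := c.perU (i + 2 * m)
    rwa [show i + 2 * (m : ℤ) + 4 * m = i + 4 * m + 2 * m by ring] at this
  perV i := by
    have := c.perV (i + 2 * m)
    rwa [show i + 2 * (m : ℤ) + 4 * m = i + 4 * m + 2 * m by ring] at this
  injU i j h := by simpa using c.injU _ _ h
  injV i j h := by simpa using c.injV _ _ h
  neUV i j := c.neUV _ _
  hx := by
    have h1 := c.perU 0
    have h2 := c.perV 0
    have h3 : (2 * m + 2 * m : ℤ) = 0 + 4 * m := by ring
    rw [zero_add] at h1 h2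
    simp only [h3, zero_add, h1, h2]
    have := c.hx
    tauto

theorem neU (c : LinkCfg m x T U V) {i j : ℤ} (h : i ≠ j) (h1 : i - j < 4 * m)
    (h2 : j - i < 4 * m) : U i ≠ U j := by
  intro e
  have := small (c.injU _ _ e) (by linarith) (by linarith)
  omega

theorem neV (c : LinkCfg m x T U V) {i j : ℤ} (h : i ≠ j) (h1 : i - j < 4 * m)
    (h2 : j - i < 4 * m) : V i ≠ V j := by
  intro e
  have := small (c.injV _ _ e) (by linarith) (by linarith)
  omega

/-- index in a rung not containing `x` -/
def Good (m : ℕ) (j : ℤ) : Prop := (0 < j ∧ j < 2 * m) ∨ (2 * m < j ∧ j < 4 * m)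

theorem uNe (c : LinkCfg m x T U V) {j : ℤ} (g : Good m j) : U j ≠ x := by
  intro e
  unfold Good at g
  rcases c.hx with h | h | h | h <;> rw [h] at e
  · exact c.neU (by omega) (by omega) (by omega) e
  · exact c.neUV _ _ e
  · exact c.neU (by omega) (by omega) (by omega) e
  · exact c.neUV _ _ e

theorem vNe (c : LinkCfg m x T U V) {j : ℤ} (g : Good m j) : V j ≠ x := by
  intro e
  unfold Good at g
  rcases c.hx with h | h | h | h <;> rw [h] at e
  · exact c.neUV _ _ e.symm
  · exact c.neV (by omega) (by omega) (by omega) e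
  · exact c.neUV _ _ e.symm
  · exact c.neV (by omega) (by omega) (by omega) e

theorem vNe' (c : LinkCfg m x T U V) {j : ℤ} (g : Good m j) : V (j + 2 * m) ≠ x := by
  unfold Good at g
  rcases g with g | g
  · exact c.vNe (Or.inr (by omega))
  · have := c.perV (j - 2 * m)
    rw [show j - 2 * (m : ℤ) + 4 * m = j + 2 * m by ring] at this
    rw [this]
    exact c.vNe (Or.inl (by omega))

theorem tVU (c : LinkCfg m x T U V) {j : ℤ} (g : Good m j) : T (U j) (V j) := by
  apply c.symm
  rcases c.ge2 _ (c.vNe g) with ⟨a, b, hab, ha, hb⟩ | ⟨h, -⟩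
  · rcases c.hV _ _ ha with rfl | rfl
    · exact ha
    · rcases c.hV _ _ hb with rfl | rfl
      · exact hb
      · exact absurd rfl hab
  · rcases c.hV _ _ h with e | e
    · exact absurd e.symm (c.uNe g)
    · exact absurd e.symm (c.vNe' g)

theorem alt (c : LinkCfg m x T U V) {j : ℤ} (g : Good m j) :
    T (U (j - 1)) (U j) ↔ ¬ T (U j) (U (j + 1)) := by
  have hm := c.hm
  have n1 : U (j - 1) ≠ U (j + 1) := c.neU (by omega) (by omega) (by omega)
  have n2 := c.neUV (j - 1) j
  have n3 := c.neUV (j + 1) j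
  constructor
  · intro h h'
    rcases c.le2 _ (c.uNe g) _ _ _ (c.symm _ _ h) h' (c.tVU g) with e | e | e
    exacts [n1 e, n2 e, n3 e]
  · intro h
    apply c.symm
    rcases c.ge2 _ (c.uNe g) with ⟨a, b, hab, ha, hb⟩ | ⟨-, h'⟩
    · rcases c.hU _ _ ha with rfl | rfl | rfl
      · exact absurd ha h
      · exact ha
      · rcases c.hU _ _ hb with rfl | rfl | rfl
        · exact absurd hb h
        · exact hb
        · exact absurd rfl hab
    · exact absurd (h' _ (c.tVU g)) (c.vNe g)

theorem noSquare (c : LinkCfg m x T U V) {j : ℤ} (h1 : 1 ≤ j) (h2 : j + 1 < 2 * m)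
    (r : T (U j) (U (j + 1))) (r' : T (U (j + 2 * m)) (U (j + 2 * m + 1))) : False := by
  have g1 : Good m j := Or.inl (by omega)
  have g2 : Good m (j + 1) := Or.inl (by omega)
  have g3 : Good m (j + 2 * m) := Or.inr (by omega)
  have g4 : Good m (j + 2 * m + 1) := Or.inr (by omega)
  have a1 : ¬ T (U j) (U (j - 1)) := fun h => (c.alt g1).1 (c.symm _ _ h) r
  have a3 : ¬ T (U (j + 2 * m)) (U (j + 2 * m - 1)) := fun h => (c.alt g3).1 (c.symm _ _ h) r'
  have a2 : ¬ T (U (j + 1)) (U (j + 1 + 1)) := (c.alt g2).1 (by simpa using r)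
  have a4 : ¬ T (U (j + 2 * m + 1)) (U (j + 2 * m + 1 + 1)) := (c.alt g4).1 (by simpa using r')
  have p1 := c.perV j
  have p2 := c.perV (j + 1)
  have key := c.conn {z | z = U j ∨ z = U (j + 1) ∨ z = V j ∨ z = V (j + 1) ∨
    z = U (j + 2 * m) ∨ z = U (j + 2 * m + 1) ∨ z = V (j + 2 * m) ∨ z = V (j + 2 * m + 1)}
    (U j) (Or.inl rfl) (by
      rintro a (rfl | rfl | rfl | rfl | rfl | rfl | rfl | rfl) b hb
      · rcases c.hU _ _ hb with rfl | rfl | rfl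
        · simp
        · exact absurd hb a1
        · simp
      · rcases c.hU _ _ hb with rfl | rfl | rfl
        · exact absurd hb a2
        · simp
        · simp
      · rcases c.hV _ _ hb with rfl | rfl <;> simp
      · rcases c.hV _ _ hb with rfl | rfl
        · simp
        · rw [show j + 1 + 2 * (m : ℤ) = j + 2 * m + 1 by ring]; simp
      · rcases c.hU _ _ hb with rfl | rfl | rfl
        · simp
        · exact absurd hb a3
        · simp
      · rcases c.hU _ _ hb with rfl | rfl | rfl
        · exact absurd hb a4
        · simp
        · simp
      · rcases c.hV _ _ hb with rfl | rfl
        · simp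
        · rw [show j + 2 * (m : ℤ) + 2 * m = j + 4 * m by ring, p1]; simp
      · rcases c.hV _ _ hb with rfl | rfl
        · simp
        · rw [show j + 2 * (m : ℤ) + 1 + 2 * m = j + 1 + 4 * m by ring, p2]; simp)
    (U 0)
  rcases key with e | e | e | e | e | e | e | e
  · exact c.neU (by omega) (by omega) (by omega) e
  · exact c.neU (by omega) (by omega) (by omega) e
  · exact c.neUV _ _ e
  · exact c.neUV _ _ e
  · exact c.neU (by omega) (by omega) (by omega) e
  · exact c.neU (by omega) (by omega) (by omega) e
  · exact c.neUV _ _ e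
  · exact c.neUV _ _ e

theorem odd1 (c : LinkCfg m x T U V) (s : ℤ) (hs : s = 0 ∨ s = 2 * m) (t : ℕ) (ht : t < m) :
    T (U (s + 2 * t + 1)) (U (s + 2 * t + 2)) ↔ T (U (s + 1)) (U (s + 2)) := by
  induction t with
  | zero => simp
  | succ t ih =>
    rw [← ih (by omega)]
    have e1 := c.alt (j := s + 2 * t + 2) (by unfold Good; omega)
    have e2 := c.alt (j := s + 2 * t + 3) (by unfold Good; omega)
    push_cast
    rw [show s + 2 * ((t : ℤ) + 1) + 1 = s + 2 * t + 3 by ring,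
      show s + 2 * ((t : ℤ) + 1) + 2 = s + 2 * t + 4 by ring]
    rw [show s + 2 * (t : ℤ) + 2 - 1 = s + 2 * t + 1 by ring,
      show s + 2 * (t : ℤ) + 2 + 1 = s + 2 * t + 3 by ring] at e1
    rw [show s + 2 * (t : ℤ) + 3 - 1 = s + 2 * t + 2 by ring,
      show s + 2 * (t : ℤ) + 3 + 1 = s + 2 * t + 4 by ring] at e2
    tauto

theorem core (c : LinkCfg m x T U V) (r : T (U 1) (U 2))
    (r' : ¬ T (U (2 * m + 1)) (U (2 * m + 2))) : False := by
  have hm := c.hm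
  have o1 := c.odd1 0 (Or.inl rfl) (m - 1) (by omega)
  have o2 := c.odd1 (2 * m) (Or.inr rfl) (m - 1) (by omega)
  rw [show (0 : ℤ) + 2 * ((m - 1 : ℕ) : ℤ) + 1 = 2 * m - 1 by omega,
    show (0 : ℤ) + 2 * ((m - 1 : ℕ) : ℤ) + 2 = 2 * m by omega] at o1
  rw [show (2 * m : ℤ) + 2 * ((m - 1 : ℕ) : ℤ) + 1 = -1 + 4 * m by omega,
    show (2 * m : ℤ) + 2 * ((m - 1 : ℕ) : ℤ) + 2 = 0 + 4 * m by omega, c.perU, c.perU] at o2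
  have q1 : T (U (2 * m - 1)) (U (2 * m)) := o1.2 (by simpa using r)
  have q2 : ¬ T (U (-1)) (U 0) := fun h => r' (o2.1 h)
  have q3 : ¬ T (U 0) (U 1) := by
    have := c.alt (j := 1) (Or.inl (by omega))
    norm_num at this
    tauto
  have q4 : T (U (2 * m)) (U (2 * m + 1)) := by
    have := c.alt (j := 2 * m + 1) (Or.inr (by omega))
    rw [show (2 * m : ℤ) + 1 - 1 = 2 * m by ring,
      show (2 * m : ℤ) + 1 + 1 = 2 * m + 2 by ring] at this
    tauto
  have only : ∀ z, T (U 0) z → z = V 0 := by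
    intro z hz
    rcases c.hU _ _ hz with rfl | rfl | rfl
    · exact absurd (by simpa using hz) q3
    · exact absurd (c.symm _ _ (by simpa using hz)) q2
    · rfl
  have hx : x = U 0 ∨ x = V 0 := by
    by_cases h : U 0 = x
    · exact Or.inl h.symm
    · rcases c.ge2 _ h with ⟨a, b, hab, ha, hb⟩ | ⟨h, -⟩
      · exact absurd ((only _ ha).trans (only _ hb).symm) hab
      · exact Or.inr (only _ h)
  have hne : U (2 * m) ≠ x := by
    rcases hx with h | h <;> rw [h]
    · exact c.neU (by omega) (by omega) (by omega)
    · exact c.neUV _ _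
  have nT : ¬ T (V (2 * m)) (U (2 * m)) := by
    intro h
    rcases c.le2 _ hne _ _ _ (c.symm _ _ q1) q4 (c.symm _ _ h) with e | e | e
    · exact c.neU (by omega) (by omega) (by omega) e
    · exact c.neUV _ _ e
    · exact c.neUV _ _ e
  have key := c.conn {z | z = U 0 ∨ z = V 0 ∨ z = V (2 * m)} (U 0) (Or.inl rfl) (by
    rintro a (rfl | rfl | rfl) b hb
    · exact Or.inr (Or.inl (only _ hb))
    · rcases c.hV _ _ hb with rfl | rfl <;> simp
    · rcases c.hV _ _ hb with rfl | rfl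
      · exact absurd hb nT
      · rw [show (2 * m : ℤ) + 2 * m = 0 + 4 * m by ring, c.perV]; simp) (U (2 * m))
  rcases key with e | e | e
  · exact c.neU (by omega) (by omega) (by omega) e
  · exact c.neUV _ _ e
  · exact c.neUV _ _ e

theorem false (c : LinkCfg m x T U V) : False := by
  have hm := c.hm
  by_cases r : T (U 1) (U 2)
  · by_cases r' : T (U (2 * m + 1)) (U (2 * m + 2))
    · apply c.noSquare (j := 1) le_rfl (by omega) (by simpa using r)
      rwa [show (1 : ℤ) + 2 * m = 2 * m + 1 by ring, show (2 : ℤ) * m + 1 + 1 = 2 * m + 2 by ring]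
    · exact c.core r r'
  · by_cases r' : T (U (2 * m + 1)) (U (2 * m + 2))
    · apply c.shift.core
      · rwa [show (1 : ℤ) + 2 * m = 2 * m + 1 by ring, show (2 : ℤ) + 2 * m = 2 * m + 2 by ring]
      · rw [show (2 * m + 1 : ℤ) + 2 * m = 1 + 4 * m by ring,
          show (2 * m + 2 : ℤ) + 2 * m = 2 + 4 * m by ring, c.perU, c.perU]
        exact r
    · have e1 := c.alt (j := 2) (Or.inl (by omega))
      have e2 := c.alt (j := 2 * m + 2) (Or.inr (by omega))
      rw [show (2 * m : ℤ) + 2 - 1 = 2 * m + 1 by ring] at e2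
      norm_num at e1
      refine c.noSquare (j := 2) (by omega) (by omega) (by norm_num; tauto) ?_
      rw [show (2 : ℤ) + 2 * m = 2 * m + 2 by ring]
      tauto

end LinkCfg

instance sumLawfulBEq {α β : Type} [DecidableEq α] [DecidableEq β] : LawfulBEq (α ⊕ β) where
  eq_of_beq := by
    rintro (a | a) (b | b) h
    · have h' : (a == b) = true := h
      rw [eq_of_beq h']
    · exact absurd h Bool.false_ne_true
    · exact absurd h Bool.false_ne_true
    · have h' : (a == b) = true := h
      rw [eq_of_beq h']
  rfl := by
    rintro (a | a)
    · exact (beq_self_eq_true a : (a == a) = true)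
    · exact (beq_self_eq_true a : (a == a) = true)

theorem beq_inst_eq {γ : Type} (B C : BEq γ) (hB : @LawfulBEq γ B) (hC : @LawfulBEq γ C) :
    B = C := by
  have h : ∀ a b, B.beq a b = C.beq a b := fun a b =>
    Bool.eq_iff_iff.2 ((@beq_iff_eq γ B hB a b).trans (@beq_iff_eq γ C hC a b).symm)
  cases B
  cases C
  congr 1
  funext a b
  exact h a b

theorem sum_count_eq {α β : Type} [DecidableEq α] [DecidableEq β] (l : List (α ⊕ β)) (x : α ⊕ β) :
    l.count x = @List.count _ instBEqOfDecidableEq x l := by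
  have h : (Sum.instBEq : BEq (α ⊕ β)) = instBEqOfDecidableEq :=
    beq_inst_eq _ _ sumLawfulBEq inferInstance
  rw [h]

/-- Link relation of a cyclic sequence. -/
def linkRel {α : Type} (f : ℕ → α) (y z : α) : Prop :=
  ∃ i, (f i = y ∧ f (i + 1) = z) ∨ (f i = z ∧ f (i + 1) = y)

section links

variable {α : Type} {f : ℕ → α} {L : ℕ} {x : α}

theorem linkRel_nbr (per : ∀ i j, i ≡ j [MOD L] → f i = f j)
    (uniq : ∀ i j, f i = f j → f i ≠ x → i ≡ j [MOD L]) {i : ℕ} (hi : f (i + 1) ≠ x) {a : α}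
    (h : linkRel f (f (i + 1)) a) : a = f i ∨ a = f (i + 2) := by
  obtain ⟨j, ⟨h1, h2⟩ | ⟨h1, h2⟩⟩ := h
  · right
    rw [← h2]
    exact per _ _ ((uniq _ _ h1 (h1 ▸ hi)).add_right 1)
  · left
    rw [← h1]
    exact per _ _ (Nat.ModEq.add_right_cancel' 1 (uniq _ _ h2 (h2 ▸ hi)))

theorem exists_succ_index (hL : 3 ≤ L) (per : ∀ i j, i ≡ j [MOD L] → f i = f j)
    (surj : ∀ y, ∃ i, f i = y) (y : α) : ∃ i, f (i + 1) = y := by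
  obtain ⟨i, rfl⟩ := surj y
  refine ⟨i + L - 1, per _ _ ?_⟩
  rw [show i + L - 1 + 1 = i + L by omega]
  simp [Nat.ModEq]

theorem linkRel_le2 (hL : 3 ≤ L) (per : ∀ i j, i ≡ j [MOD L] → f i = f j)
    (surj : ∀ y, ∃ i, f i = y)
    (uniq : ∀ i j, f i = f j → f i ≠ x → i ≡ j [MOD L]) (y : α) (hy : y ≠ x) (a b c : α)
    (ha : linkRel f y a) (hb : linkRel f y b) (hc : linkRel f y c) :
    a = b ∨ a = c ∨ b = c := by
  obtain ⟨i, rfl⟩ := exists_succ_index hL per surj y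
  rcases linkRel_nbr per uniq hy ha with rfl | rfl <;>
  rcases linkRel_nbr per uniq hy hb with rfl | rfl <;>
  rcases linkRel_nbr per uniq hy hc with rfl | rfl <;> simp

theorem linkRel_ge2 (hL : 3 ≤ L) (per : ∀ i j, i ≡ j [MOD L] → f i = f j)
    (surj : ∀ y, ∃ i, f i = y)
    (uniq : ∀ i j, f i = f j → f i ≠ x → i ≡ j [MOD L]) (y : α) (hy : y ≠ x) :
    (∃ a b, a ≠ b ∧ linkRel f y a ∧ linkRel f y b) ∨
      (linkRel f y x ∧ ∀ a, linkRel f y a → a = x) := by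
  obtain ⟨i, rfl⟩ := exists_succ_index hL per surj y
  have t1 : linkRel f (f (i + 1)) (f i) := ⟨i, Or.inr ⟨rfl, rfl⟩⟩
  have t2 : linkRel f (f (i + 1)) (f (i + 2)) := ⟨i + 1, Or.inl ⟨rfl, rfl⟩⟩
  by_cases h : f i = f (i + 2)
  · right
    have hx : f i = x := by
      by_contra hne
      have := uniq _ _ h hne
      have h2 : 0 ≡ 2 [MOD L] := Nat.ModEq.add_left_cancel' i this
      have h3 := (Nat.modEq_zero_iff_dvd.1 h2.symm)
      have := Nat.le_of_dvd (by norm_num) h3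
      omega
    refine ⟨hx ▸ t1, fun a ha => ?_⟩
    rcases linkRel_nbr per uniq hy ha with rfl | rfl
    · exact hx
    · rw [← h, hx]
  · exact Or.inl ⟨_, _, h, t1, t2⟩

theorem linkRel_conn (hL : 3 ≤ L) (per : ∀ i j, i ≡ j [MOD L] → f i = f j)
    (surj : ∀ y, ∃ i, f i = y) (S : Set α) (y : α) (hy : y ∈ S)
    (hS : ∀ a ∈ S, ∀ b, linkRel f a b → b ∈ S) (z : α) : z ∈ S := by
  obtain ⟨i, rfl⟩ := surj y
  obtain ⟨j, rfl⟩ := surj z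
  have key : ∀ t, f (i + t) ∈ S := by
    intro t
    induction t with
    | zero => exact hy
    | succ t ih => exact hS _ ih _ ⟨i + t, Or.inl ⟨rfl, rfl⟩⟩
  have h1 : i ≤ L * i := Nat.le_mul_of_pos_left i (by omega)
  have := key (j + L * i - i)
  rw [show i + (j + L * i - i) = j + L * i by omega] at this
  rwa [per (j + L * i) j (by simp [Nat.ModEq])] at this

end links

/-- Residue of an integer as an element of `Fin n`. -/
def resFin (n : ℕ) (hn : 0 < n) (i : ℤ) : Fin n :=
  ⟨(i % n).toNat, by
    have := Int.emod_lt_of_pos i (show (0 : ℤ) < n by omega)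
    have := Int.emod_nonneg i (show (n : ℤ) ≠ 0 by omega)
    omega⟩

theorem resFin_dvd (n : ℕ) (hn : 0 < n) (i : ℤ) : (n : ℤ) ∣ (resFin n hn i : ℕ) - i := by
  have := Int.emod_nonneg i (show (n : ℤ) ≠ 0 by omega)
  simp only [resFin]
  rw [Int.toNat_of_nonneg this]
  have := Int.emod_add_mul_ediv i n
  exact ⟨-(i / n), by linarith⟩

theorem eq_resFin {n : ℕ} (hn : 0 < n) {i : ℤ} {p : Fin n} (h : (n : ℤ) ∣ (p : ℕ) - i) :
    p = resFin n hn i := by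
  have h2 := dvd_sub h (resFin_dvd n hn i)
  have := p.2
  have := (resFin n hn i).2
  have := LinkCfg.small h2 (by omega) (by omega)
  ext
  omega

theorem resFin_inj {n : ℕ} (hn : 0 < n) {i j : ℤ} (h : resFin n hn i = resFin n hn j) :
    (n : ℤ) ∣ i - j := by
  have h1 := resFin_dvd n hn i
  have h2 := resFin_dvd n hn j
  rw [h] at h1
  have := dvd_sub h2 h1
  rwa [show ((resFin n hn j : ℕ) : ℤ) - j - ((resFin n hn j : ℕ) - i) = i - j by ring] at this

theorem mod_step {n : ℕ} {p q : Fin n} {k : ℕ} (h : (q : ℕ) = ((p : ℕ) + k) % n) :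
    (n : ℤ) ∣ (q : ℕ) - ((p : ℕ) + k) := by
  have h2 := Nat.mod_add_div ((p : ℕ) + k) n
  rw [← h] at h2
  refine ⟨-(((p : ℕ) + k) / n : ℕ), ?_⟩
  have h3 : ((q : ℕ) : ℤ) + n * (((p : ℕ) + k) / n : ℕ) = (p : ℕ) + k := by exact_mod_cast h2
  linarith

theorem res_step {n : ℕ} (hn : 0 < n) {i : ℤ} {q : Fin n} {k : ℕ}
    (h : (q : ℕ) = ((resFin n hn i : ℕ) + k) % n) : q = resFin n hn (i + k) := by
  apply eq_resFin
  have := dvd_add (mod_step h) (resFin_dvd n hn i)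
  rwa [show ((q : ℕ) : ℤ) - ((resFin n hn i : ℕ) + k) + ((resFin n hn i : ℕ) - i)
    = (q : ℕ) - (i + k) by ring] at this

theorem res_step' {n : ℕ} (hn : 0 < n) {i : ℤ} {q : Fin n} {k : ℕ}
    (h : (resFin n hn i : ℕ) = ((q : ℕ) + k) % n) : q = resFin n hn (i - k) := by
  apply eq_resFin
  have := dvd_sub (resFin_dvd n hn i) (mod_step h)
  rwa [show ((resFin n hn i : ℕ) : ℤ) - i - ((resFin n hn i : ℕ) - ((q : ℕ) + k))
    = (q : ℕ) - (i - k) by ring] at this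

theorem resFin_per {n : ℕ} (hn : 0 < n) (i : ℤ) : resFin n hn (i + n) = resFin n hn i := by
  simp [resFin]

theorem no_cyclic {m : ℕ} (hm : 3 ≤ m) {f : ℕ → Fin (4 * m) ⊕ Fin (4 * m)} {L : ℕ}
    {x : Fin (4 * m) ⊕ Fin (4 * m)} (hL : 3 ≤ L)
    (per : ∀ i j, i ≡ j [MOD L] → f i = f j) (surj : ∀ y, ∃ i, f i = y)
    (uniq : ∀ i j, f i = f j → f i ≠ x → i ≡ j [MOD L])
    (adj : ∀ i, (generalizedPetersen (4 * m) (2 * m)).Adj (f i) (f (i + 1))) : False := by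
  have hn : 0 < 4 * m := by omega
  have tadj : ∀ a b, linkRel f a b → (generalizedPetersen (4 * m) (2 * m)).Adj a b := by
    rintro a b ⟨i, ⟨rfl, rfl⟩ | ⟨rfl, rfl⟩⟩
    · exact adj i
    · exact (adj i).symm
  obtain ⟨c, hc⟩ : ∃ c : ℕ, c < 4 * m ∧ ∀ h : c < 4 * m, x = Sum.inl ⟨c, h⟩ ∨ x = Sum.inr ⟨c, h⟩ := by
    rcases x with p | p
    · exact ⟨p, p.2, fun _ => Or.inl rfl⟩
    · exact ⟨p, p.2, fun _ => Or.inr rfl⟩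
  obtain ⟨hc1, hc2⟩ := hc
  have hc0 : (⟨c, hc1⟩ : Fin (4 * m)) = resFin _ hn (c + 0) := eq_resFin hn (by simp)
  have cast4 : ((4 * m : ℕ) : ℤ) = 4 * m := by push_cast; ring
  have cfg : LinkCfg m x (linkRel f) (fun i => Sum.inl (resFin _ hn (c + i)))
      (fun i => Sum.inr (resFin _ hn (c + i))) := {
    hm := hm
    symm := by
      rintro a b ⟨i, h | h⟩
      exacts [⟨i, Or.inr h⟩, ⟨i, Or.inl h⟩]
    le2 := linkRel_le2 hL per surj uniq
    ge2 := linkRel_ge2 hL per surj uniq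
    conn := linkRel_conn hL per surj
    hU := by
      intro i z h
      have h := tadj _ _ h
      simp only [generalizedPetersen, SimpleGraph.fromRel_adj] at h
      rcases z with q | q
      · rcases h.2 with h | h
        · left
          have := res_step hn h
          rw [this]; push_cast; rw [add_assoc]
        · right; left
          have := res_step' hn h
          rw [this]; push_cast; rw [add_sub_assoc]
      · rcases h.2 with h | h
        · right; right
          simp only [gpRel] at h
          rw [Fin.ext h]
        · exact h.elim
    hV := by
      intro i z h
      have h := tadj _ _ h
      simp only [generalizedPetersen, SimpleGraph.fromRel_adj] at h
      rcases z with q | q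
      · rcases h.2 with h | h
        · exact h.elim
        · left
          simp only [gpRel] at h
          rw [← Fin.ext h]
      · right
        rcases h.2 with h | h
        · have := res_step hn h
          rw [this]; push_cast; rw [add_assoc]
        · have := res_step' hn h
          rw [this, ← resFin_per]; push_cast; congr 2; ring
    perU := by
      intro i
      have := resFin_per hn (c + i)
      rw [cast4, add_assoc] at this
      simp only [this]
    perV := by
      intro i
      have := resFin_per hn (c + i)
      rw [cast4, add_assoc] at this
      simp only [this]
    injU := by
      intro i j h
      have := resFin_inj hn (Sum.inl.inj h)
      rw [cast4] at this
      simpa using this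
    injV := by
      intro i j h
      have := resFin_inj hn (Sum.inr.inj h)
      rw [cast4] at this
      simpa using this
    neUV := by simp
    hx := by
      rw [← hc0]
      have := hc2 hc1
      tauto }
  exact cfg.false

theorem no_walk {m : ℕ} (hm : 3 ≤ m) (a b : Fin (4 * m) ⊕ Fin (4 * m))
    (hab : (generalizedPetersen (4 * m) (2 * m)).Adj a b)
    (W : (generalizedPetersen (4 * m) (2 * m)).Walk a b)
    (hW : ∀ x, x ∈ W.support)
    (hc : (Finset.univ.filter fun x => 1 < W.support.count x).card ≤ 1) : False := by
  have : Nonempty (Fin (4 * m) ⊕ Fin (4 * m)) := ⟨a⟩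
  obtain ⟨x, hx⟩ := Finset.card_le_one_iff_subset_singleton.1 hc
  have hx' : ∀ y, y ≠ x → ¬ 1 < W.support.count y := by
    intro y hy h
    have := hx (Finset.mem_filter.2 ⟨Finset.mem_univ y, h⟩)
    exact hy (by simpa using this)
  have hlen : W.support.length = W.length + 1 := W.length_support
  have hcard : 8 * m ≤ W.length + 1 := by
    have h1 : W.support.toFinset = Finset.univ := by
      ext z; simp [hW z]
    have h2 := W.support.toFinset_card_le
    rw [h1, Finset.card_univ, Fintype.card_sum, Fintype.card_fin, hlen] at h2
    omega
  refine no_cyclic hm (f := fun i => W.getVert (i % (W.length + 1))) (L := W.length + 1) (x := x)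
    (by omega) ?_ ?_ ?_ ?_
  · intro i j h
    simp only [show i % (W.length + 1) = j % (W.length + 1) from h]
  · intro y
    obtain ⟨i, hi, hl⟩ := Walk.mem_support_iff_exists_getVert.1 (hW y)
    exact ⟨i, by rw [Nat.mod_eq_of_lt (by omega)]; exact hi⟩
  · intro i j h hne
    by_contra hij
    have hij' : i % (W.length + 1) ≠ j % (W.length + 1) := hij
    have key : ∀ s t, s < t → t < W.length + 1 → W.getVert s = W.getVert t →
        W.getVert s = x := by
      intro s t hst ht e
      by_contra hne
      apply hx' _ hne
      have : W.support.Duplicate (W.getVert s) := by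
        rw [List.duplicate_iff_exists_distinct_get]
        refine ⟨⟨s, by omega⟩, ⟨t, by omega⟩, hst, ?_, ?_⟩
        · simp [Walk.support_getElem_eq_getVert]
        · simp [Walk.support_getElem_eq_getVert, e]
      have h2 := List.duplicate_iff_two_le_count.1 this
      rw [sum_count_eq]
      exact h2
    have li := Nat.mod_lt i (show 0 < W.length + 1 by omega)
    have lj := Nat.mod_lt j (show 0 < W.length + 1 by omega)
    rcases lt_or_gt_of_ne hij' with h' | h'
    · exact hne (key _ _ h' lj h)
    · exact hne (h.trans (key _ _ h' li h.symm))
  · intro i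
    have li := Nat.mod_lt i (show 0 < W.length + 1 by omega)
    have e : (i + 1) % (W.length + 1) = (i % (W.length + 1) + 1) % (W.length + 1) := by simp
    simp only [e]
    by_cases h : i % (W.length + 1) < W.length
    · rw [Nat.mod_eq_of_lt (a := i % (W.length + 1) + 1) (by omega)]
      exact W.adj_getVert_succ h
    · have h2 : i % (W.length + 1) = W.length := by omega
      rw [h2]
      simpa using hab.symm

/-- Outer and inner vertices by natural index. -/
def uu (m i : ℕ) (h : i < 4 * m) : Fin (4 * m) ⊕ Fin (4 * m) := Sum.inl ⟨i, h⟩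

/-- Inner vertex by natural index. -/
def vv (m i : ℕ) (h : i < 4 * m) : Fin (4 * m) ⊕ Fin (4 * m) := Sum.inr ⟨i, h⟩

theorem adj_uu {m i j : ℕ} (hi : i < 4 * m) (hj : j < 4 * m) (h : j = i + 1) :
    (generalizedPetersen (4 * m) (2 * m)).Adj (uu m i hi) (uu m j hj) := by
  simp only [generalizedPetersen, SimpleGraph.fromRel_adj, uu]
  refine ⟨by simp; omega, Or.inl ?_⟩
  simp only [gpRel]
  rw [Nat.mod_eq_of_lt (by omega), h]

theorem adj_uv {m i : ℕ} (hi : i < 4 * m) :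
    (generalizedPetersen (4 * m) (2 * m)).Adj (uu m i hi) (vv m i hi) := by
  simp [generalizedPetersen, SimpleGraph.fromRel_adj, uu, vv, gpRel]

theorem adj_vv {m i j : ℕ} (hi : i < 4 * m) (hj : j < 4 * m) (h : j = i + 2 * m) :
    (generalizedPetersen (4 * m) (2 * m)).Adj (vv m i hi) (vv m j hj) := by
  simp only [generalizedPetersen, SimpleGraph.fromRel_adj, vv]
  refine ⟨by simp; omega, Or.inl ?_⟩
  simp only [gpRel]
  rw [Nat.mod_eq_of_lt (by omega), h]

theorem zigzag {m : ℕ} (hm : 3 ≤ m) (t : ℕ) (ht : 2 * t + 1 < 2 * m) :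
    ∃ W : (generalizedPetersen (4 * m) (2 * m)).Walk
        (uu m (2 * m + 1) (by omega)) (uu m (2 * t + 1) (by omega)),
      ∀ (i : ℕ) (hi : i < 4 * m),
        W.support.count (uu m i hi) = (if (1 ≤ i ∧ i ≤ 2 * t + 1) ∨
          (2 * m + 1 ≤ i ∧ i ≤ 2 * m + 2 * t + 1) then 1 else 0) ∧
        W.support.count (vv m i hi) = (if (1 ≤ i ∧ i ≤ 2 * t + 1) ∨
          (2 * m + 1 ≤ i ∧ i ≤ 2 * m + 2 * t + 1) then 1 else 0) := by
  induction t with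
  | zero =>
    refine ⟨Walk.cons (adj_uv (i := 2 * m + 1) (by omega))
      (Walk.cons (adj_vv (i := 1) (by omega) _ (by omega)).symm
      (Walk.cons (adj_uv (by omega)).symm Walk.nil)), ?_⟩
    intro i hi
    simp only [Walk.support_cons, Walk.support_nil, List.count_cons, List.count_nil]
    simp only [uu, vv,
      beq_iff_eq, Sum.inl.injEq, Sum.inr.injEq, Fin.mk.injEq, reduceCtorEq, if_false]
    constructor <;> split_ifs <;> omega
  | succ t ih =>
    obtain ⟨W, hW⟩ := ih (by omega)
    refine ⟨W.append
      (Walk.cons (adj_uu (j := 2 * t + 2) (by omega) (by omega) (by omega))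
      (Walk.cons (adj_uv (by omega))
      (Walk.cons (adj_vv (j := 2 * m + 2 * t + 2) (by omega) (by omega) (by omega))
      (Walk.cons (adj_uv (by omega)).symm
      (Walk.cons (adj_uu (j := 2 * m + 2 * t + 3) (by omega) (by omega) (by omega))
      (Walk.cons (adj_uv (by omega))
      (Walk.cons (adj_vv (i := 2 * (t + 1) + 1) (by omega) (by omega) (by omega)).symm
      (Walk.cons (adj_uv (by omega)).symm Walk.nil)))))))), ?_⟩
    intro i hi
    obtain ⟨h1, h2⟩ := hW i hi
    rw [Walk.support_append, List.count_append, List.count_append, h1, h2]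
    clear h1 h2 hW
    simp only [Walk.support_cons, Walk.support_nil, List.tail_cons, List.count_cons,
      List.count_nil]
    simp only [uu, vv,
      beq_iff_eq, Sum.inl.injEq, Sum.inr.injEq, Fin.mk.injEq, reduceCtorEq, if_false]
    constructor <;> split_ifs <;> omega

theorem three_walk {m : ℕ} (hm : 3 ≤ m) :
    ∃ (a b : Fin (4 * m) ⊕ Fin (4 * m)) (_ : (generalizedPetersen (4 * m) (2 * m)).Adj a b)
        (W : (generalizedPetersen (4 * m) (2 * m)).Walk a b),
      (∀ x : Fin (4 * m) ⊕ Fin (4 * m), x ∈ W.support) ∧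
      (Finset.univ.filter fun x : Fin (4 * m) ⊕ Fin (4 * m) => 1 < W.support.count x).card = 3 := by
  obtain ⟨Z, hZ⟩ := zigzag hm (m - 1) (by omega)
  let E := Walk.cons (adj_uu (m := m) (i := 2 * (m - 1) + 1) (j := 2 * m) (by omega) (by omega) (by omega))
      (Walk.cons (adj_uv (by omega))
      (Walk.cons (adj_vv (i := 0) (by omega) (by omega) (by omega)).symm Walk.nil))
  let W := Walk.cons (adj_uv (m := m) (i := 0) (by omega))
      (Walk.cons (adj_vv (j := 2 * m) (by omega) (by omega) (by omega))
      (Walk.cons (adj_uv (by omega)).symm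
      (Walk.cons (adj_uu (j := 2 * m + 1) (by omega) (by omega) (by omega)) (Z.append E))))
  have hu : ∀ i hi, W.support.count (uu m i hi) = if i = 2 * m then 2 else 1 := by
    intro i hi
    simp only [W, E, Walk.support_cons, Walk.support_append, List.count_cons, List.count_append,
      (hZ i hi).1]
    simp only [Walk.support_nil, List.tail_cons, List.count_cons,
      List.count_nil]
    simp only [uu, vv,
      beq_iff_eq, Sum.inl.injEq, Sum.inr.injEq, Fin.mk.injEq, reduceCtorEq, if_false]
    split_ifs <;> omega
  have hv : ∀ i hi, W.support.count (vv m i hi) = if i = 0 ∨ i = 2 * m then 2 else 1 := by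
    intro i hi
    simp only [W, E, Walk.support_cons, Walk.support_append, List.count_cons, List.count_append,
      (hZ i hi).2]
    simp only [Walk.support_nil, List.tail_cons, List.count_cons,
      List.count_nil]
    simp only [uu, vv,
      beq_iff_eq, Sum.inl.injEq, Sum.inr.injEq, Fin.mk.injEq, reduceCtorEq, if_false]
    split_ifs <;> omega
  refine ⟨_, _, adj_uv (by omega), W, ?_, ?_⟩
  · intro x
    rw [← List.count_pos_iff]
    rcases x with ⟨i, hi⟩ | ⟨i, hi⟩
    · have := hu i hi
      change W.support.count (Sum.inl ⟨i, hi⟩) = _ at this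
      rw [this]; split_ifs <;> omega
    · have := hv i hi
      change W.support.count (Sum.inr ⟨i, hi⟩) = _ at this
      rw [this]; split_ifs <;> omega
  · have : (Finset.univ.filter fun x => 1 < W.support.count x) =
        {uu m (2 * m) (by omega), vv m 0 (by omega), vv m (2 * m) (by omega)} := by
      ext x
      rcases x with ⟨i, hi⟩ | ⟨i, hi⟩
      · have := hu i hi
        change W.support.count (Sum.inl ⟨i, hi⟩) = _ at this
        simp only [Finset.mem_filter, Finset.mem_univ, true_and, this]
        simp only [uu, vv, Finset.mem_insert,
          Finset.mem_singleton, Sum.inl.injEq, Fin.mk.injEq, reduceCtorEq, or_false]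
        split_ifs <;> simp_all
      · have := hv i hi
        change W.support.count (Sum.inr ⟨i, hi⟩) = _ at this
        simp only [Finset.mem_filter, Finset.mem_univ, true_and, this]
        simp only [uu, vv, Finset.mem_insert,
          Finset.mem_singleton, Sum.inr.injEq, Fin.mk.injEq, reduceCtorEq, false_or]
        split_ifs <;> simp_all
    rw [this, Finset.card_eq_three]
    refine ⟨_, _, _, ?_, ?_, ?_, rfl⟩
    · simp [uu, vv]
    · simp [uu, vv]
    · simp [vv]; omega

/-- For every `n` divisible by `4` with `n > 8`, the generalized Petersen graph `GP(n, n/2)`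
contains a 3-Unbounded Hamiltonian Cycle (a walk visiting every vertex, with adjacent start
and end vertices, in which exactly three vertices occur more than once); combined with the
nonexistence of a 1-Unbounded Hamiltonian Cycle, the minimum `k` for which a `k`-Unbounded
Hamiltonian Cycle exists satisfies `2 ≤ m ≤ 3`. -/
theorem generalizedPetersen_three_unbounded_hamiltonian_cycle
    (n : ℕ) (h4 : 4 ∣ n) (h8 : 8 < n) :
    (∃ (a b : Fin n ⊕ Fin n) (_ : (generalizedPetersen n (n / 2)).Adj a b)
        (W : (generalizedPetersen n (n / 2)).Walk a b),
      (∀ x : Fin n ⊕ Fin n, x ∈ W.support) ∧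
      (Finset.univ.filter fun x : Fin n ⊕ Fin n => 1 < W.support.count x).card = 3) ∧
    ∃ m : ℕ, IsLeast {k : ℕ |
        ∃ (a b : Fin n ⊕ Fin n) (_ : (generalizedPetersen n (n / 2)).Adj a b)
          (W : (generalizedPetersen n (n / 2)).Walk a b),
        (∀ x : Fin n ⊕ Fin n, x ∈ W.support) ∧
        (Finset.univ.filter fun x : Fin n ⊕ Fin n => 1 < W.support.count x).card = k} m ∧
      2 ≤ m ∧ m ≤ 3 := by
  obtain ⟨m, rfl⟩ := h4
  have hm : 3 ≤ m := by omega
  rw [show 4 * m / 2 = 2 * m by omega]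
  have h3 := three_walk hm
  refine ⟨h3, ?_⟩
  classical
  have hex : ∃ k : ℕ, k ∈ {k : ℕ |
        ∃ (a b : Fin (4 * m) ⊕ Fin (4 * m)) (_ : (generalizedPetersen (4 * m) (2 * m)).Adj a b)
          (W : (generalizedPetersen (4 * m) (2 * m)).Walk a b),
        (∀ x : Fin (4 * m) ⊕ Fin (4 * m), x ∈ W.support) ∧
        (Finset.univ.filter fun x : Fin (4 * m) ⊕ Fin (4 * m) =>
          1 < W.support.count x).card = k} := ⟨3, h3⟩
  refine ⟨Nat.find hex, ⟨Nat.find_spec hex, fun k hk => Nat.find_min' hex hk⟩, ?_,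
    Nat.find_min' hex h3⟩
  obtain ⟨a, b, hab, W, hW, hc⟩ := Nat.find_spec hex
  by_contra hlt
  exact no_walk hm a b hab W hW (by omega)
end
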